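/- Let the complex K_⋄ be the sequence of cyclic coinvariants 0 → (U¹)_{G₁} → (U²)_{G₂} → ⋯ → (Uⁿ)_{Gₙ} → ⋯ with differential induced by b₁(v₁⋯vₙ) = Σ_{i=1}^n (-1)^{i+1} v₁⋯v_i(a+b)v_{i+1}⋯vₙ, where G_n acts by g_n(v₁⋯vₙ) = (-1)^{n-1} v₂⋯vₙv₁. Then H^m(K_⋄) ≅ K if m is a positive odd integer and H^m(K_⋄) = 0 otherwise; moreover H^{2n+1}(K_⋄) is spanned by the class of (a+b)^{⊗(2n+1)}. -/

import Mathlib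

/-- The degree-`n` component `Uⁿ = V^{⊗n}` for `V = span{a,b}` (a, b of degree 1),
realized as functions on words of length `n` over `{a,b}` (encoded as `Bool`). -/
abbrev Wd (K : Type) (n : ℕ) := (Fin n → Bool) → K

/-- The insertion differential `b₁(v₁⋯vₙ) = Σ_{i=1}^n (-1)^{i+1} v₁⋯vᵢ(a+b)v_{i+1}⋯vₙ`. -/
def b1 (K : Type) [Field K] (n : ℕ) (X : Wd K n) : Wd K (n + 1) :=
  fun w => ∑ p : Fin (n + 1),
    (if (p : ℕ) = 0 then 0 else (-1 : K) ^ ((p : ℕ) + 1)) * X (fun j => w (p.succAbove j))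

/-- The generator `gₙ` of the cyclic group `Gₙ` acting on `Uⁿ` by
`gₙ(v₁ ⋯ vₙ) = (-1)^{n-1} v₂ ⋯ vₙ v₁`, in the function model. -/
def gcyc (K : Type) [Field K] (n : ℕ) (X : Wd K n) : Wd K n :=
  fun w => (-1 : K) ^ (n - 1) * X (fun j => w ((finRotate n).symm j))

/-- The relation submodule defining the coinvariant space `(Uⁿ)_{Gₙ}`:
the span of all elements `Y - gₙ(Y)`. -/
def Ncyc (K : Type) [Field K] (n : ℕ) : Submodule K (Wd K n) :=
  Submodule.span K {Z : Wd K n | ∃ Y : Wd K n, Z = Y - gcyc K n Y}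

section CyclicInsertion

variable {K : Type} [Field K]

/-- The insertion differential as a linear map. -/
def insertionMap (K : Type) [Field K] (n : ℕ) : Wd K n →ₗ[K] Wd K (n + 1) where
  toFun := b1 K n
  map_add' X Y := by
    ext w
    simp [b1, mul_add, Finset.sum_add_distrib]
  map_smul' c X := by
    ext w
    simp only [b1, Pi.smul_apply, smul_eq_mul, RingHom.id_apply, Finset.mul_sum]
    exact Finset.sum_congr rfl fun p _ => by ring

/-- The signed rotation as a linear map. -/
def rotationMap (K : Type) [Field K] (n : ℕ) : Wd K n →ₗ[K] Wd K n where
  toFun := gcyc K n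
  map_add' X Y := by
    ext w
    simp [gcyc, mul_add]
  map_smul' c X := by
    ext w
    simp [gcyc, mul_left_comm]

/-- The part of an element whose first letter is `x`. -/
def headPart (x : Bool) (n : ℕ) : Wd K (n + 1) →ₗ[K] Wd K n where
  toFun X w := X (Fin.cons x w : Fin (n + 1) → Bool)
  map_add' _ _ := rfl
  map_smul' _ _ := rfl

/-- The part of an element whose last letter is `x`. -/
def lastPart (x : Bool) (n : ℕ) : Wd K (n + 1) →ₗ[K] Wd K n where
  toFun X w := X (Fin.snoc w x : Fin (n + 1) → Bool)
  map_add' _ _ := rfl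
  map_smul' _ _ := rfl

/-- Left multiplication by `a + b`. -/
def prepend (n : ℕ) : Wd K n →ₗ[K] Wd K (n + 1) where
  toFun X w := X (Fin.tail w)
  map_add' _ _ := rfl
  map_smul' _ _ := rfl

/-- Insertion of `a + b` after the first letter. -/
def insertSecond (n : ℕ) : Wd K (n + 1) →ₗ[K] Wd K (n + 2) where
  toFun X w := X (Fin.cons (w 0) (Fin.tail (Fin.tail w)) : Fin (n + 1) → Bool)
  map_add' _ _ := rfl
  map_smul' _ _ := rfl

/-- The derivation of degree `-1` with `a ↦ 0` and `b ↦ 1`. -/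
def contraction (n : ℕ) : Wd K (n + 1) →ₗ[K] Wd K n where
  toFun X w := ∑ p : Fin (n + 1),
    (-1 : K) ^ (p : ℕ) * X (p.insertNth true w : Fin (n + 1) → Bool)
  map_add' X Y := by
    ext w
    simp [mul_add, Finset.sum_add_distrib]
  map_smul' c X := by
    ext w
    simp only [Pi.smul_apply, smul_eq_mul, RingHom.id_apply, Finset.mul_sum]
    exact Finset.sum_congr rfl fun p _ => by ring

/-- The derivation of degree `0` with `a ↦ a` and `a + b ↦ 0`. -/
def weight (n : ℕ) : Wd K n →ₗ[K] Wd K n where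
  toFun X w := ∑ i : Fin n, (X w - X (Function.update w i true))
  map_add' X Y := by
    ext w
    simp only [Pi.add_apply, ← Finset.sum_add_distrib]
    exact Finset.sum_congr rfl fun p _ => by ring
  map_smul' c X := by
    ext w
    simp only [Pi.smul_apply, smul_eq_mul, RingHom.id_apply, Finset.mul_sum]
    exact Finset.sum_congr rfl fun p _ => by ring

lemma ext_headPart {n : ℕ} {X Y : Wd K (n + 1)}
    (h : ∀ x, headPart x n X = headPart x n Y) : X = Y := by
  ext w
  simpa [headPart] using congrFun (h (w 0)) (Fin.tail w)

lemma ext_lastPart {n : ℕ} {X Y : Wd K (n + 1)}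
    (h : ∀ x, lastPart x n X = lastPart x n Y) : X = Y := by
  ext w
  simpa [lastPart] using congrFun (h (w (Fin.last n))) (Fin.init w)

lemma headPart_prepend (x : Bool) (n : ℕ) (X : Wd K n) :
    headPart x n (prepend n X) = X := by
  ext w
  simp [headPart, prepend]

lemma headPart_lastPart (x y : Bool) (n : ℕ) (X : Wd K (n + 2)) :
    headPart x n (lastPart y (n + 1) X) = lastPart y n (headPart x (n + 1) X) := by
  ext w
  simp [headPart, lastPart, Fin.cons_snoc_eq_snoc_cons]

lemma insertionMap_zero (X : Wd K 0) : insertionMap K 0 X = 0 := by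
  ext w
  simp [insertionMap, b1]

lemma headPart_insertionMap (x : Bool) (n : ℕ) (X : Wd K (n + 1)) :
    headPart x (n + 1) (insertionMap K (n + 1) X) =
      prepend n (headPart x n X) - insertionMap K n (headPart x n X) := by
  ext w
  have key (p : Fin (n + 1)) :
      (fun j => (Fin.cons x w : Fin (n + 2) → Bool) (p.succ.succAbove j)) =
        (Fin.cons x (fun j => w (p.succAbove j)) : Fin (n + 1) → Bool) := by
    ext j
    refine Fin.cases ?_ (fun j => ?_) j <;> simp
  simp only [headPart, insertionMap, prepend, LinearMap.coe_mk, AddHom.coe_mk, b1,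
    Pi.sub_apply]
  rw [Fin.sum_univ_succ]
  simp only [key]
  rw [Fin.sum_univ_succ, Fin.sum_univ_succ (n := n)]
  simp [pow_succ, Fin.tail_def, sub_eq_add_neg]

lemma lastPart_insertionMap (x : Bool) (n : ℕ) (X : Wd K (n + 1)) :
    lastPart x (n + 1) (insertionMap K (n + 1) X) =
      insertionMap K n (lastPart x n X) + (-1 : K) ^ n • X := by
  ext w
  have key (p : Fin (n + 1)) :
      (fun j => (Fin.snoc w x : Fin (n + 2) → Bool) (p.castSucc.succAbove j)) =
        (Fin.snoc (fun j => w (p.succAbove j)) x : Fin (n + 1) → Bool) := by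
    ext j
    refine Fin.lastCases ?_ (fun j => ?_) j
    · simp
    · rw [Fin.castSucc_succAbove_castSucc, Fin.snoc_castSucc, Fin.snoc_castSucc]
  simp only [lastPart, insertionMap, LinearMap.coe_mk, AddHom.coe_mk, b1,
    Pi.add_apply, Pi.smul_apply, smul_eq_mul]
  rw [Fin.sum_univ_castSucc]
  simp only [key]
  simp [pow_succ]

lemma headPart_contraction (x : Bool) (n : ℕ) (X : Wd K (n + 2)) :
    headPart x n (contraction (n + 1) X) =
      headPart x n (headPart true (n + 1) X) - contraction n (headPart x (n + 1) X) := by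
  ext w
  have key (p : Fin (n + 1)) :
      (p.succ.insertNth true (Fin.cons x w : Fin (n + 1) → Bool) : Fin (n + 2) → Bool) =
        (Fin.cons x (p.insertNth true w : Fin (n + 1) → Bool) : Fin (n + 2) → Bool) := by
    rw [Fin.insertNth_eq_iff]
    refine ⟨by simp, ?_⟩
    ext j
    refine Fin.cases ?_ (fun j => ?_) j <;> simp [Fin.removeNth]
  simp only [headPart, contraction, LinearMap.coe_mk, AddHom.coe_mk, Pi.sub_apply]
  rw [Fin.sum_univ_succ]
  simp only [key]
  simp [pow_succ, sub_eq_add_neg]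

lemma lastPart_contraction (x : Bool) (n : ℕ) (X : Wd K (n + 2)) :
    lastPart x n (contraction (n + 1) X) =
      contraction n (lastPart x (n + 1) X) +
        (-1 : K) ^ (n + 1) • lastPart x n (lastPart true (n + 1) X) := by
  ext w
  have key (p : Fin (n + 1)) :
      (p.castSucc.insertNth true (Fin.snoc w x : Fin (n + 1) → Bool) : Fin (n + 2) → Bool) =
        (Fin.snoc (p.insertNth true w : Fin (n + 1) → Bool) x : Fin (n + 2) → Bool) := by
    rw [Fin.insertNth_eq_iff]
    refine ⟨by simp, ?_⟩
    ext j
    refine Fin.lastCases ?_ (fun j => ?_) j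
    · simp [Fin.removeNth]
    · simp only [Fin.removeNth, Fin.castSucc_succAbove_castSucc, Fin.snoc_castSucc,
        Fin.insertNth_apply_succAbove]
  simp only [lastPart, contraction, LinearMap.coe_mk, AddHom.coe_mk, Pi.add_apply,
    Pi.smul_apply, smul_eq_mul]
  rw [Fin.sum_univ_castSucc]
  simp only [key]
  simp

lemma headPart_weight (x : Bool) (n : ℕ) (X : Wd K (n + 1)) :
    headPart x n (weight (n + 1) X) =
      headPart x n X - headPart true n X + weight n (headPart x n X) := by
  ext w
  simp only [headPart, weight, LinearMap.coe_mk, AddHom.coe_mk, Pi.add_apply, Pi.sub_apply]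
  rw [Fin.sum_univ_succ]
  simp [← Fin.cons_update]

lemma lastPart_rotationMap (x : Bool) (n : ℕ) (X : Wd K (n + 1)) :
    lastPart x n (rotationMap K (n + 1) X) = (-1 : K) ^ n • headPart x n X := by
  ext w
  have key : (fun j => (Fin.snoc w x : Fin (n + 1) → Bool) ((finRotate (n + 1)).symm j)) =
      (Fin.cons x w : Fin (n + 1) → Bool) := by
    ext j
    obtain ⟨i, rfl⟩ := (finRotate (n + 1)).surjective j
    rw [Equiv.symm_apply_apply]
    refine Fin.lastCases ?_ (fun i => ?_) i
    · simp
    · have : finRotate (n + 1) i.castSucc = i.succ := by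
        ext
        simp
      simp [this]
  simp only [lastPart, headPart, rotationMap, gcyc, LinearMap.coe_mk, AddHom.coe_mk, key,
    Pi.smul_apply, smul_eq_mul, Nat.add_sub_cancel]

lemma insertionMap_prepend (n : ℕ) (X : Wd K n) :
    insertionMap K (n + 1) (prepend n X) =
      prepend (n + 1) (prepend n X) - prepend (n + 1) (insertionMap K n X) := by
  refine ext_headPart fun x => ?_
  simp only [headPart_insertionMap, map_sub, headPart_prepend]

lemma contraction_prepend (n : ℕ) (X : Wd K (n + 1)) :
    contraction (n + 1) (prepend (n + 1) X) = X - prepend n (contraction n X) := by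
  refine ext_headPart fun x => ?_
  simp only [headPart_contraction, map_sub, headPart_prepend]

lemma insertionMap_insertionMap (n : ℕ) (X : Wd K n) :
    insertionMap K (n + 1) (insertionMap K n X) = 0 := by
  induction n with
  | zero => rw [insertionMap_zero, map_zero]
  | succ n ih =>
    refine ext_headPart fun x => ?_
    simp only [headPart_insertionMap, map_sub, map_zero, insertionMap_prepend, ih]
    abel

lemma insertionMap_contraction_add (n : ℕ) (X : Wd K (n + 1)) :
    insertionMap K n (contraction n X) + contraction (n + 1) (insertionMap K (n + 1) X) =
      -weight (n + 1) X := by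
  induction n with
  | zero =>
    have hc (Y : Wd K 1) : contraction 0 Y = headPart true 0 Y := by
      ext w
      simp [contraction, headPart]
    have hw (Y : Wd K 0) : weight 0 Y = 0 := by
      ext w
      simp [weight]
    refine ext_headPart fun x => ?_
    simp only [insertionMap_zero, zero_add, headPart_contraction, headPart_insertionMap, hc,
      headPart_prepend, headPart_weight, hw, map_neg, sub_zero, add_zero]
    abel
  | succ n ih =>
    refine ext_headPart fun x => ?_
    have := ih (headPart x (n + 1) X)
    simp only [map_add, map_neg, headPart_contraction, headPart_insertionMap, map_sub,
      headPart_prepend, headPart_weight, contraction_prepend]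
    rw [neg_add, ← this]
    abel

lemma sub_rotationMap_mem (n : ℕ) (X : Wd K n) : X - rotationMap K n X ∈ Ncyc K n :=
  Submodule.subset_span ⟨X, rfl⟩

lemma rotationMap_insertSecond (n : ℕ) (X : Wd K (n + 1)) :
    rotationMap K (n + 2) (rotationMap K (n + 2) (insertSecond n X)) -
        rotationMap K (n + 2) (insertSecond n X) =
      insertionMap K (n + 1) (rotationMap K (n + 1) X) -
        rotationMap K (n + 2) (insertionMap K (n + 1) X) := by
  have hs (x : Bool) : headPart x (n + 1) (insertSecond n X) = prepend n (headPart x n X) := by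
    ext w
    simp [headPart, insertSecond, prepend]
  have hr (x : Bool) : headPart x (n + 1) (rotationMap K (n + 2) (insertSecond n X)) =
      -rotationMap K (n + 1) X := by
    refine ext_lastPart fun y => ?_
    rw [← headPart_lastPart, lastPart_rotationMap, hs, map_smul, headPart_prepend, map_neg,
      lastPart_rotationMap]
    simp [pow_succ]
  refine ext_lastPart fun x => ?_
  simp only [map_sub, lastPart_rotationMap, lastPart_insertionMap, headPart_insertionMap, hr, hs,
    map_smul]
  simp only [pow_succ]
  module

lemma insertionMap_mem {n : ℕ} {X : Wd K (n + 1)} (hX : X ∈ Ncyc K (n + 1)) :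
    insertionMap K (n + 1) X ∈ Ncyc K (n + 2) := by
  refine (Submodule.span_le (p := (Ncyc K (n + 2)).comap (insertionMap K (n + 1)))).2 ?_ hX
  rintro _ ⟨Y, rfl⟩
  have h := (Ncyc K (n + 2)).add_mem (sub_rotationMap_mem _ (insertionMap K (n + 1) Y))
    (sub_rotationMap_mem _ (rotationMap K (n + 2) (insertSecond n Y)))
  have e := rotationMap_insertSecond n Y
  change insertionMap K (n + 1) (Y - rotationMap K (n + 1) Y) ∈ Ncyc K (n + 2)
  convert h using 1
  rw [← neg_sub (rotationMap K (n + 2) (rotationMap K (n + 2) _)), e, map_sub]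
  abel

lemma contraction_mem {n : ℕ} {X : Wd K (n + 2)} (hX : X ∈ Ncyc K (n + 2)) :
    contraction (n + 1) X ∈ Ncyc K (n + 1) := by
  refine (Submodule.span_le (p := (Ncyc K (n + 1)).comap (contraction (n + 1)))).2 ?_ hX
  rintro _ ⟨Y, rfl⟩
  have h := (Ncyc K (n + 1)).sub_mem (sub_rotationMap_mem _ (contraction (n + 1) Y))
    (sub_rotationMap_mem _ (headPart true (n + 1) Y))
  change contraction (n + 1) (Y - rotationMap K (n + 2) Y) ∈ Ncyc K (n + 1)
  convert h using 1
  have hsq : (-1 : K) ^ n * (-1 : K) ^ n = 1 := by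
    rw [← mul_pow]
    simp
  refine ext_lastPart fun x => ?_
  simp only [map_sub, lastPart_rotationMap, lastPart_contraction, headPart_contraction, map_smul,
    smul_smul]
  simp only [pow_succ, mul_neg, neg_mul, mul_one, neg_neg, hsq]
  module

/-- The element is a combination of words in `a` and `a + b` with at most `k` letters `a`. -/
def WeightAtMost : (n k : ℕ) → Wd K n → Prop
  | 0, _, _ => True
  | n + 1, 0, X => WeightAtMost n 0 (headPart true n X) ∧
      headPart false n X - headPart true n X = 0
  | n + 1, k + 1, X => WeightAtMost n (k + 1) (headPart true n X) ∧
      WeightAtMost n k (headPart false n X - headPart true n X)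

lemma weightAtMost_of_le {n k : ℕ} (h : n ≤ k) (X : Wd K n) : WeightAtMost n k X := by
  induction n generalizing k with
  | zero => trivial
  | succ n ih =>
    obtain ⟨k, rfl⟩ : ∃ l, k = l + 1 := ⟨k - 1, by omega⟩
    exact ⟨ih (by omega) _, ih (by omega) _⟩

lemma WeightAtMost.exists_eq_smul_one {n : ℕ} {X : Wd K n} (h : WeightAtMost n 0 X) :
    ∃ c : K, X = c • (fun _ => 1) := by
  induction n with
  | zero =>
    refine ⟨X default, ?_⟩
    ext w
    simp [Subsingleton.elim w default]
  | succ n ih =>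
    obtain ⟨c, hc⟩ := ih h.1
    have hf := sub_eq_zero.1 h.2
    refine ⟨c, ext_headPart fun x => ?_⟩
    cases x
    · rw [hf, hc]
      rfl
    · rw [hc]
      rfl

lemma weight_smul_one (n : ℕ) (c : K) : weight n (c • (fun _ => 1) : Wd K n) = 0 := by
  ext w
  simp [weight]

lemma WeightAtMost.weight_sub {n k : ℕ} {X : Wd K n} (h : WeightAtMost n (k + 1) X) :
    WeightAtMost n k (weight n X - ((k : K) + 1) • X) := by
  induction n generalizing k with
  | zero => cases k <;> trivial
  | succ n ih =>
    have ht : headPart true n (weight (n + 1) X - ((k : K) + 1) • X) =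
        weight n (headPart true n X) - ((k : K) + 1) • headPart true n X := by
      simp [headPart_weight]
    have hd : headPart false n (weight (n + 1) X - ((k : K) + 1) • X) -
          headPart true n (weight (n + 1) X - ((k : K) + 1) • X) =
        weight n (headPart false n X - headPart true n X) -
          (k : K) • (headPart false n X - headPart true n X) := by
      simp only [map_sub, map_smul, headPart_weight]
      module
    cases k with
    | zero =>
      refine ⟨by rw [ht]; exact ih h.1, ?_⟩
      obtain ⟨c, hc⟩ := h.2.exists_eq_smul_one
      rw [hd, hc, weight_smul_one]
      simp
    | succ k =>
      refine ⟨by rw [ht]; exact ih h.1, ?_⟩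
      rw [hd, Nat.cast_succ]
      exact ih h.2

lemma exists_of_insertionMap_mem [CharZero K] {n k : ℕ} {X : Wd K (n + 1)}
    (hk : WeightAtMost (n + 1) k X) (hX : insertionMap K (n + 1) X ∈ Ncyc K (n + 2)) :
    ∃ (c : K) (Y : Wd K n), X - c • (fun _ => 1) - insertionMap K n Y ∈ Ncyc K (n + 1) := by
  induction k generalizing X with
  | zero =>
    obtain ⟨c, rfl⟩ := hk.exists_eq_smul_one
    exact ⟨c, 0, by simp⟩
  | succ k ih =>
    have hN : weight (n + 1) X = -(insertionMap K n (contraction n X) +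
        contraction (n + 1) (insertionMap K (n + 1) X)) := by
      rw [insertionMap_contraction_add, neg_neg]
    have hδ := contraction_mem hX
    have hcoc : insertionMap K (n + 1) (weight (n + 1) X - ((k : K) + 1) • X) ∈
        Ncyc K (n + 2) := by
      rw [map_sub, map_smul, hN, map_neg, map_add, insertionMap_insertionMap, zero_add]
      exact sub_mem (neg_mem (insertionMap_mem hδ)) (Submodule.smul_mem _ _ hX)
    obtain ⟨c, Y, h⟩ := ih hk.weight_sub hcoc
    have hk0 : (k : K) + 1 ≠ 0 := Nat.cast_add_one_ne_zero k
    refine ⟨-((k : K) + 1)⁻¹ * c, -((k : K) + 1)⁻¹ • (contraction n X + Y), ?_⟩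
    have := Submodule.smul_mem _ (-((k : K) + 1)⁻¹) (add_mem h hδ)
    convert this using 1
    rw [hN, map_smul, map_add]
    have e : X = ((k : K) + 1)⁻¹ • ((k : K) + 1) • X := by
      rw [smul_smul, inv_mul_cancel₀ hk0, one_smul]
    nth_rewrite 1 [e]
    module

lemma smul_one_mem_of_odd [CharZero K] {n : ℕ} (hn : Odd n) (c : K) :
    c • (fun _ => 1) ∈ Ncyc K (n + 1) := by
  refine Submodule.subset_span ⟨(c / 2) • (fun _ => 1), ?_⟩
  ext w
  simp [gcyc, hn.neg_one_pow]

lemma apply_true_eq_zero {n : ℕ} (hn : Even n) {X : Wd K (n + 1)} (hX : X ∈ Ncyc K (n + 1)) :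
    X (fun _ => true) = 0 := by
  refine (Submodule.span_le (p := LinearMap.ker
    (LinearMap.proj (R := K) (φ := fun _ : Fin (n + 1) → Bool => K) fun _ => true))).2 ?_ hX
  rintro _ ⟨Y, rfl⟩
  simp [gcyc, hn.neg_one_pow]

lemma b1_apply_true (n : ℕ) (X : Wd K n) :
    b1 K n X (fun _ => true) = if Even n then 0 else X fun _ => true := by
  rw [b1, Fin.sum_univ_succ, ← Finset.sum_mul]
  simp [pow_succ, Fin.sum_univ_eq_sum_range (fun i => (-1 : K) ^ i), neg_one_geom_sum]

end CyclicInsertion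

/-- The cohomology of the complex of cyclic coinvariants
`K_⋄ : 0 → (U¹)_{G₁} → (U²)_{G₂} → ⋯` (with differential induced by `b₁`):
`H^m(K_⋄) ≅ K` for `m` positive odd, spanned by the class of
`(a+b)^{⊗m}` (the constant function 1), and `H^m(K_⋄) = 0` otherwise.
Cohomology is phrased at the level of representatives, an element of `Uⁿ`
being zero in `(Uⁿ)_{Gₙ}` iff it lies in `Ncyc K n`. -/
theorem Kdiamond_cohomology (K : Type) [Field K] [CharZero K] :
    -- (a+b)^{⊗(2t+1)} is a cocycle in the coinvariant complex
    (∀ t : ℕ, b1 K (2 * t + 1) ((fun _ => 1) : Wd K (2 * t + 1)) ∈ Ncyc K (2 * t + 2)) ∧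
    -- H¹ is spanned by the class of a+b …
    (∀ X : Wd K 1, b1 K 1 X ∈ Ncyc K 2 →
      ∃ c : K, X - c • ((fun _ => 1) : Wd K 1) ∈ Ncyc K 1) ∧
    -- … and that class is nonzero
    (((fun _ => 1) : Wd K 1) ∉ Ncyc K 1) ∧
    -- H^{2t+3} is spanned by the class of (a+b)^{⊗(2t+3)} …
    (∀ t : ℕ, ∀ X : Wd K (2 * t + 3), b1 K (2 * t + 3) X ∈ Ncyc K (2 * t + 4) →
      ∃ (c : K) (Y : Wd K (2 * t + 2)),
        X - c • ((fun _ => 1) : Wd K (2 * t + 3)) - b1 K (2 * t + 2) Y ∈ Ncyc K (2 * t + 3)) ∧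
    -- … and that class is nonzero
    (∀ t : ℕ, ∀ Y : Wd K (2 * t + 2),
      ((fun _ => 1) : Wd K (2 * t + 3)) - b1 K (2 * t + 2) Y ∉ Ncyc K (2 * t + 3)) ∧
    -- the cohomology vanishes in even degrees
    (∀ t : ℕ, ∀ X : Wd K (2 * t + 2), b1 K (2 * t + 2) X ∈ Ncyc K (2 * t + 3) →
      ∃ Y : Wd K (2 * t + 1), X - b1 K (2 * t + 1) Y ∈ Ncyc K (2 * t + 2)) := by
  have main (n : ℕ) (X : Wd K (n + 1)) (hX : b1 K (n + 1) X ∈ Ncyc K (n + 2)) :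
      ∃ (c : K) (Y : Wd K n), X - c • (fun _ => 1) - b1 K n Y ∈ Ncyc K (n + 1) :=
    exists_of_insertionMap_mem (weightAtMost_of_le le_rfl X) hX
  refine ⟨fun t => ?_, fun X hX => ?_, fun h => ?_, fun t X hX => main _ X hX, fun t Y h => ?_,
    fun t X hX => ?_⟩
  · have h : b1 K (2 * t + 1) (fun _ => 1) =
        (b1 K (2 * t + 1) (fun _ => 1) fun _ => true) • (fun _ => 1) := by
      ext w
      simp [b1]
    rw [h]
    exact smul_one_mem_of_odd ⟨t, rfl⟩ _
  · obtain ⟨c, Y, h⟩ := main 0 X hX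
    have h0 : b1 K 0 Y = 0 := insertionMap_zero Y
    exact ⟨c, by simpa [h0] using h⟩
  · simpa using apply_true_eq_zero Even.zero h
  · have he : Even (2 * t + 2) := ⟨t + 1, by ring⟩
    simpa [b1_apply_true, he] using apply_true_eq_zero he h
  · obtain ⟨c, Y, h⟩ := main _ X hX
    refine ⟨Y, ?_⟩
    convert add_mem h (smul_one_mem_of_odd ⟨t, rfl⟩ c) using 1
    abel
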